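/- Let X ⊆ ℝ^d be a Delaunay set with parameters 0 < r < R, let T be a uniformly bounded triangulation of X with parameter q, and let F be a real-valued functional on d-simplices such that e ≤ F(Δ) ≤ E for every d-simplex Δ all of whose edges have length at least 2r and whose circumradius is at most q. Then for every z ∈ ℝ^d one has f_z(T) = f(T), where f_z(T) = liminf_{α→∞} (1/vol(B_α(z))) · Σ_{Δ ⊆ B_α(z)} F(Δ) and f(T) is the same expression with balls centered at the origin; i.e., the density is independent of the choice of center. -/

import Mathlib

open Metric MeasureTheory Filter

noncomputable section

/-- A Delaunay set with parameters `r < R`: every open ball of radius `r` contains at most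
one point of `X`, and every closed ball of radius `R` contains at least one point of `X`. -/
def DelaunaySet (d : ℕ) (X : Set (EuclideanSpace ℝ (Fin d))) (r R : ℝ) : Prop :=
  (∀ z : EuclideanSpace ℝ (Fin d), (X ∩ Metric.ball z r).Subsingleton) ∧
  (∀ z : EuclideanSpace ℝ (Fin d), (X ∩ Metric.closedBall z R).Nonempty)

/-- `T` is a triangulation of `X`: a simplicial complex with vertex set exactly `X`
whose underlying space is all of `ℝ^d`. -/
def IsTriangulationOf (d : ℕ) (T : Geometry.SimplicialComplex ℝ (EuclideanSpace ℝ (Fin d)))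
    (X : Set (EuclideanSpace ℝ (Fin d))) : Prop :=
  T.vertices = X ∧ T.space = Set.univ

/-- The finset `s` admits an enclosing sphere with radius at most `q` passing through all
its vertices; for a `d`-simplex in `ℝ^d` this says its circumradius is at most `q`. -/
def HasCircumradiusLE (d : ℕ) (s : Finset (EuclideanSpace ℝ (Fin d))) (q : ℝ) : Prop :=
  ∃ c : EuclideanSpace ℝ (Fin d), ∃ ρ : ℝ, ρ ≤ q ∧ ∀ v ∈ s, dist v c = ρ

/-- `T` is uniformly bounded with parameter `q`: every `d`-simplex of `T` has
circumradius at most `q`. -/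
def UniformlyBounded (d : ℕ) (T : Geometry.SimplicialComplex ℝ (EuclideanSpace ℝ (Fin d)))
    (q : ℝ) : Prop :=
  ∀ s ∈ T.faces, s.card = d + 1 → HasCircumradiusLE d s q

/-- The density of a functional `F` on a triangulation `T`, with balls centered at `z`:
the lower limit, as `α → ∞`, of the sum of `F` over the `d`-simplices of `T` contained in
`B_α(z)`, divided by the volume of `B_α(z)`. -/
def densityAt (d : ℕ) (F : Finset (EuclideanSpace ℝ (Fin d)) → ℝ)
    (T : Geometry.SimplicialComplex ℝ (EuclideanSpace ℝ (Fin d)))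
    (z : EuclideanSpace ℝ (Fin d)) : ℝ :=
  Filter.liminf (fun α : ℝ =>
    (∑ᶠ s ∈ {s : Finset (EuclideanSpace ℝ (Fin d)) |
        s ∈ T.faces ∧ s.card = d + 1 ∧
          (s : Set (EuclideanSpace ℝ (Fin d))) ⊆ Metric.closedBall z α},
      F s) /
    (MeasureTheory.volume (Metric.closedBall z α)).toReal)
    Filter.atTop

/-- Perturbing a real function by a function tending to zero does not change its lower limit,
even when the lower limit takes a default value. -/
theorem Real.liminf_eq_of_tendsto_sub {ι : Type*} {l : Filter ι} {f g : ι → ℝ}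
    (h : Tendsto (fun i => f i - g i) l (nhds 0)) : liminf f l = liminf g l := by
  have key : ∀ {f g : ι → ℝ}, Tendsto (fun i => f i - g i) l (nhds 0) →
      ∀ ε > 0, ∀ a ∈ {a | ∀ᶠ i in l, a ≤ f i}, a - ε ∈ {a | ∀ᶠ i in l, a ≤ g i} := by
    intro f g h ε hε a ha
    filter_upwards [ha, h.eventually_lt_const hε] with i h₁ h₂
    linarith
  have h' : Tendsto (fun i => g i - f i) l (nhds 0) := by
    simpa using h.neg
  have hne : ∀ {f g : ι → ℝ}, Tendsto (fun i => f i - g i) l (nhds 0) →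
      {a | ∀ᶠ i in l, a ≤ f i}.Nonempty → {a | ∀ᶠ i in l, a ≤ g i}.Nonempty :=
    fun h ⟨a, ha⟩ => ⟨_, key h 1 one_pos a ha⟩
  have hbdd : ∀ {f g : ι → ℝ}, Tendsto (fun i => f i - g i) l (nhds 0) →
      BddAbove {a | ∀ᶠ i in l, a ≤ g i} → BddAbove {a | ∀ᶠ i in l, a ≤ f i} := by
    rintro f g h ⟨b, hb⟩
    exact ⟨b + 1, fun a ha => by linarith [hb (key h 1 one_pos a ha)]⟩
  have hle : ∀ {f g : ι → ℝ}, Tendsto (fun i => f i - g i) l (nhds 0) →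
      {a | ∀ᶠ i in l, a ≤ f i}.Nonempty → BddAbove {a | ∀ᶠ i in l, a ≤ g i} →
      sSup {a | ∀ᶠ i in l, a ≤ f i} ≤ sSup {a | ∀ᶠ i in l, a ≤ g i} := by
    intro f g h hf hg
    refine csSup_le hf fun a ha => le_of_forall_pos_le_add fun ε hε => ?_
    linarith [le_csSup hg (key h ε hε a ha)]
  rw [liminf_eq, liminf_eq]
  by_cases hf : {a | ∀ᶠ i in l, a ≤ f i}.Nonempty
  · by_cases hg : BddAbove {a | ∀ᶠ i in l, a ≤ g i}
    · exact (hle h hf hg).antisymm (hle h' (hne h hf) (hbdd h hg))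
    · rw [Real.sSup_of_not_bddAbove hg, Real.sSup_of_not_bddAbove fun hf' => hg (hbdd h' hf')]
  · have hg : ¬{a | ∀ᶠ i in l, a ≤ g i}.Nonempty := fun hg => hf (hne h' hg)
    rw [Set.not_nonempty_iff_eq_empty.1 hf, Set.not_nonempty_iff_eq_empty.1 hg]

/-- Two distinct points of a Delaunay set are at distance at least `2 * r`. -/
theorem DelaunaySet.two_mul_le_dist {d : ℕ} {X : Set (EuclideanSpace ℝ (Fin d))} {r R : ℝ}
    (hX : DelaunaySet d X r R) {u v : EuclideanSpace ℝ (Fin d)} (hu : u ∈ X) (hv : v ∈ X)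
    (huv : u ≠ v) : 2 * r ≤ dist u v := by
  by_contra! hlt
  refine huv (hX.1 (midpoint ℝ u v) ⟨hu, ?_⟩ ⟨hv, ?_⟩)
  · rw [mem_ball, dist_left_midpoint, Real.norm_ofNat]
    linarith
  · rw [mem_ball, dist_right_midpoint, Real.norm_ofNat]
    linarith

/-- Packing bound: the balls of radius `r` around points of a Delaunay set are disjoint. -/
theorem DelaunaySet.card_mul_le {d : ℕ} {X : Set (EuclideanSpace ℝ (Fin d))} {r R : ℝ}
    (hX : DelaunaySet d X r R) (P : Finset (EuclideanSpace ℝ (Fin d))) (hP : ↑P ⊆ X)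
    (U : Set (EuclideanSpace ℝ (Fin d))) (hU : volume U ≠ ⊤) (hPU : ∀ x ∈ P, ball x r ⊆ U) :
    P.card * volume.real (ball (0 : EuclideanSpace ℝ (Fin d)) r) ≤ volume.real U := by
  have hdisj : Set.PairwiseDisjoint (↑P) fun x : EuclideanSpace ℝ (Fin d) => ball x r := by
    intro u hu v hv huv
    refine ball_disjoint_ball ?_
    linarith [hX.two_mul_le_dist (hP hu) (hP hv) huv]
  calc P.card * volume.real (ball (0 : EuclideanSpace ℝ (Fin d)) r)
      = ∑ x ∈ P, volume.real (ball x r) := by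
        simp [Measure.addHaar_real_ball_center volume _ r]
    _ = volume.real (⋃ x ∈ P, ball x r) :=
        (measureReal_biUnion_finset hdisj (fun _ _ => measurableSet_ball)
          (fun _ _ => measure_ball_lt_top.ne)).symm
    _ ≤ volume.real U := measureReal_mono (Set.iUnion₂_subset hPU) hU

theorem volume_real_ball_zero_pos (d : ℕ) {r : ℝ} (hr : 0 < r) :
    0 < volume.real (ball (0 : EuclideanSpace ℝ (Fin d)) r) :=
  ENNReal.toReal_pos (measure_ball_pos _ _ hr).ne' measure_ball_lt_top.ne

/-- A Delaunay set has a uniformly bounded number of points in balls of fixed radius. -/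
theorem DelaunaySet.exists_card_le {d : ℕ} {X : Set (EuclideanSpace ℝ (Fin d))} {r R : ℝ}
    (hr : 0 < r) (hX : DelaunaySet d X r R) (ρ : ℝ) :
    ∃ N : ℕ, ∀ z, ∀ P : Finset (EuclideanSpace ℝ (Fin d)), ↑P ⊆ X ∩ closedBall z ρ →
      P.card ≤ N := by
  refine ⟨⌊volume.real (closedBall (0 : EuclideanSpace ℝ (Fin d)) (ρ + r)) /
    volume.real (ball (0 : EuclideanSpace ℝ (Fin d)) r)⌋₊, fun z P hP => Nat.le_floor ?_⟩
  rw [le_div_iff₀ (volume_real_ball_zero_pos d hr),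
    ← Measure.addHaar_real_closedBall_center volume z]
  refine hX.card_mul_le P (fun x hx => (hP hx).1) _ measure_closedBall_lt_top.ne fun x hx => ?_
  refine ball_subset_closedBall.trans (closedBall_subset_closedBall' ?_)
  linarith [mem_closedBall.1 (hP hx).2]

theorem DelaunaySet.finite_inter_closedBall {d : ℕ} {X : Set (EuclideanSpace ℝ (Fin d))}
    {r R : ℝ} (hr : 0 < r) (hX : DelaunaySet d X r R) (z : EuclideanSpace ℝ (Fin d)) (ρ : ℝ) :
    (X ∩ closedBall z ρ).Finite := by
  obtain ⟨N, hN⟩ := hX.exists_card_le hr ρ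
  by_contra hinf
  obtain ⟨P, hP, hcard⟩ := Set.Infinite.exists_subset_card_eq hinf (N + 1)
  have := hN z P hP
  omega

/-- The number of points of a Delaunay set lying in one ball of radius `α` but not in another one
of the same radius is bounded by the volume of a shell. -/
theorem DelaunaySet.card_shell_le {d : ℕ} {X : Set (EuclideanSpace ℝ (Fin d))} {r R : ℝ}
    (hX : DelaunaySet d X r R) (z w : EuclideanSpace ℝ (Fin d)) {α : ℝ} (hr : 0 < r) (hα : r ≤ α)
    (P : Finset (EuclideanSpace ℝ (Fin d)))
    (hP : ↑P ⊆ X ∩ (closedBall z α \ closedBall w α)) :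
    P.card * volume.real (ball (0 : EuclideanSpace ℝ (Fin d)) r) ≤
      ((α + (dist z w + r)) ^ d - (α - r) ^ d) *
        volume.real (ball (0 : EuclideanSpace ℝ (Fin d)) 1) := by
  have hsub : closedBall w (α - r) ⊆ closedBall w (α + (dist z w + r)) :=
    closedBall_subset_closedBall (by linarith [dist_nonneg (x := z) (y := w)])
  have hvol : volume.real (closedBall w (α + (dist z w + r)) \ closedBall w (α - r)) =
      ((α + (dist z w + r)) ^ d - (α - r) ^ d) *
        volume.real (ball (0 : EuclideanSpace ℝ (Fin d)) 1) := by
    rw [measureReal_sdiff hsub measurableSet_closedBall measure_closedBall_lt_top.ne,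
      Measure.addHaar_real_closedBall volume w
        (by linarith [dist_nonneg (x := z) (y := w)]),
      Measure.addHaar_real_closedBall volume w (by linarith), finrank_euclideanSpace_fin]
    ring
  rw [← hvol]
  refine hX.card_mul_le P (fun x hx => (hP hx).1) _
    (measure_ne_top_of_subset Set.sdiff_subset measure_closedBall_lt_top.ne) fun x hx y hy => ?_
  obtain ⟨-, hxz, hxw⟩ := hP hx
  rw [mem_closedBall] at hxz hxw
  rw [mem_ball] at hy
  refine ⟨mem_closedBall.2 ?_, fun hyw => hxw ?_⟩
  · linarith [dist_triangle y x w, dist_triangle x z w]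
  · linarith [dist_triangle x y w, dist_comm x y, mem_closedBall.1 hyw]

theorem HasCircumradiusLE.dist_le {d : ℕ} {s : Finset (EuclideanSpace ℝ (Fin d))} {q : ℝ}
    (hs : HasCircumradiusLE d s q) {u v : EuclideanSpace ℝ (Fin d)} (hu : u ∈ s) (hv : v ∈ s) :
    dist u v ≤ 2 * q := by
  obtain ⟨c, ρ, hρ, hc⟩ := hs
  linarith [dist_triangle_right u v c, hc u hu, hc v hv]

/-- A family of finite subsets of `X` of uniformly bounded diameter has, up to a constant factor,
at most as many members in one ball and not in another as `X` has points. -/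
theorem DelaunaySet.exists_card_le_mul {d : ℕ} {X : Set (EuclideanSpace ℝ (Fin d))} {r R : ℝ}
    (hr : 0 < r) (hX : DelaunaySet d X r R) (q : ℝ) :
    ∃ K : ℝ, ∀ z w : EuclideanSpace ℝ (Fin d), ∀ α, r ≤ α →
      ∀ A : Finset (Finset (EuclideanSpace ℝ (Fin d))),
      (∀ s ∈ A, ↑s ⊆ X ∧ (∀ u ∈ s, ∀ v ∈ s, dist u v ≤ q) ∧
        (s : Set (EuclideanSpace ℝ (Fin d))) ⊆ closedBall z α ∧
        ¬(s : Set (EuclideanSpace ℝ (Fin d))) ⊆ closedBall w α) →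
      A.card ≤ K * ((α + (dist z w + r)) ^ d - (α - r) ^ d) := by
  classical
  obtain ⟨N, hN⟩ := hX.exists_card_le hr q
  have hr' := volume_real_ball_zero_pos d hr
  refine ⟨2 ^ N * volume.real (ball (0 : EuclideanSpace ℝ (Fin d)) 1) /
    volume.real (ball (0 : EuclideanSpace ℝ (Fin d)) r), fun z w α hα A hA => ?_⟩
  have hfin : (X ∩ (closedBall z α \ closedBall w α)).Finite :=
    (hX.finite_inter_closedBall hr z α).subset fun x hx => ⟨hx.1, hx.2.1⟩
  have hcover : A ⊆ hfin.toFinset.biUnion fun v =>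
      (hX.finite_inter_closedBall hr v q).toFinset.powerset := by
    intro s hs
    obtain ⟨hsX, hsq, hsz, hsw⟩ := hA s hs
    obtain ⟨v, hv, hvw⟩ := Set.not_subset.1 hsw
    refine Finset.mem_biUnion.2 ⟨v, hfin.mem_toFinset.2 ⟨hsX hv, hsz hv, hvw⟩,
      Finset.mem_powerset.2 fun u hu => ?_⟩
    exact (Set.Finite.mem_toFinset _).2 ⟨hsX hu, mem_closedBall.2 (hsq u hu v hv)⟩
  have hcard : A.card ≤ hfin.toFinset.card * 2 ^ N := by
    refine (Finset.card_le_card hcover).trans (Finset.card_biUnion_le_card_mul _ _ _ fun v _ => ?_)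
    rw [Finset.card_powerset]
    exact Nat.pow_le_pow_right two_pos (hN v _ (by simp))
  have hshell := hX.card_shell_le z w hr hα hfin.toFinset (by simp)
  calc (A.card : ℝ) ≤ hfin.toFinset.card * 2 ^ N := by exact_mod_cast hcard
    _ = 2 ^ N * (hfin.toFinset.card * volume.real (ball (0 : EuclideanSpace ℝ (Fin d)) r)) /
        volume.real (ball (0 : EuclideanSpace ℝ (Fin d)) r) := by field_simp
    _ ≤ 2 ^ N * (((α + (dist z w + r)) ^ d - (α - r) ^ d) *
        volume.real (ball (0 : EuclideanSpace ℝ (Fin d)) 1)) /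
        volume.real (ball (0 : EuclideanSpace ℝ (Fin d)) r) := by gcongr
    _ = _ := by ring

/-- The volume of a shell of fixed thickness is negligible relative to that of the ball. -/
theorem tendsto_add_pow_sub_sub_pow_div_pow (d : ℕ) (a b : ℝ) :
    Tendsto (fun α : ℝ => ((α + a) ^ d - (α - b) ^ d) / α ^ d) atTop (nhds 0) := by
  have h : ∀ c : ℝ, Tendsto (fun α : ℝ => (1 + c / α) ^ d) atTop (nhds 1) := fun c => by
    simpa using ((tendsto_const_nhds (x := c)).div_atTop tendsto_id |>.const_add 1).pow d
  have h' := (h a).sub (h (-b))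
  rw [sub_self] at h'
  refine h'.congr' ?_
  filter_upwards [eventually_gt_atTop 0] with α hα
  rw [sub_div, ← div_pow, ← div_pow, add_div, sub_div, div_self hα.ne', neg_div, ← sub_eq_add_neg]

/-- The density of a functional (bounded on the relevant simplices) on a uniformly bounded
triangulation of a Delaunay set is independent of the choice of center of the balls. -/
theorem density_center_independent (d : ℕ) (X : Set (EuclideanSpace ℝ (Fin d))) (r R : ℝ)
    (hr : 0 < r) (hrR : r < R) (hX : DelaunaySet d X r R)
    (T : Geometry.SimplicialComplex ℝ (EuclideanSpace ℝ (Fin d)))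
    (hT : IsTriangulationOf d T X) (q : ℝ) (hq : 0 < q) (hTq : UniformlyBounded d T q)
    (F : Finset (EuclideanSpace ℝ (Fin d)) → ℝ) (e E : ℝ)
    (hF : ∀ s : Finset (EuclideanSpace ℝ (Fin d)), s.card = d + 1 →
      (∀ u ∈ s, ∀ v ∈ s, u ≠ v → 2 * r ≤ dist u v) →
      HasCircumradiusLE d s q → e ≤ F s ∧ F s ≤ E) :
    ∀ z : EuclideanSpace ℝ (Fin d), densityAt d F T z = densityAt d F T 0 := by
  classical
  intro z
  have hsX : ∀ s ∈ T.faces, ∀ v ∈ s, v ∈ X := fun s hs v hv => by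
    rw [← hT.1]
    exact T.down_closed hs (Finset.singleton_subset_iff.2 hv) (Finset.singleton_nonempty v)
  have hFM : ∀ s ∈ T.faces, s.card = d + 1 → |F s| ≤ max |e| |E| := fun s hs hcard => by
    obtain ⟨h₁, h₂⟩ := hF s hcard
      (fun u hu v hv huv => hX.two_mul_le_dist (hsX s hs u hu) (hsX s hs v hv) huv)
      (hTq s hs hcard)
    exact abs_le_max_abs_abs h₁ h₂
  set M := max |e| |E|
  have hM : 0 ≤ M := (abs_nonneg e).trans (le_max_left _ _)
  have hfin : ∀ w α, {s : Finset (EuclideanSpace ℝ (Fin d)) | s ∈ T.faces ∧ s.card = d + 1 ∧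
      (s : Set (EuclideanSpace ℝ (Fin d))) ⊆ closedBall w α}.Finite := fun w α => by
    refine (hX.finite_inter_closedBall hr w α).toFinset.powerset.finite_toSet.subset
      fun s hs => ?_
    refine Finset.mem_coe.2 (Finset.mem_powerset.2 fun v hv => ?_)
    exact (Set.Finite.mem_toFinset _).2 ⟨hsX s hs.1 v hv, hs.2.2 hv⟩
  obtain ⟨K, hcard⟩ := hX.exists_card_le_mul hr (2 * q)
  have hsum : ∀ w w' α, r ≤ α → ∑ s ∈ (hfin w α).toFinset \ (hfin w' α).toFinset, |F s| ≤
      M * (K * ((α + (dist w w' + r)) ^ d - (α - r) ^ d)) := fun w w' α hα => by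
    refine (Finset.sum_le_card_nsmul _ _ M fun s hs => ?_).trans ?_
    · rw [Finset.mem_sdiff, Set.Finite.mem_toFinset] at hs
      exact hFM s hs.1.1 hs.1.2.1
    · rw [nsmul_eq_mul, mul_comm]
      refine mul_le_mul_of_nonneg_left (hcard w w' α hα _ fun s hs => ?_) hM
      rw [Finset.mem_sdiff, Set.Finite.mem_toFinset, Set.Finite.mem_toFinset] at hs
      obtain ⟨⟨hs₁, hs₂, hs₃⟩, hs₄⟩ := hs
      exact ⟨hsX s hs₁, fun u hu v hv => (hTq s hs₁ hs₂).dist_le hu hv, hs₃,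
        fun h => hs₄ ⟨hs₁, hs₂, h⟩⟩
  have hV := volume_real_ball_zero_pos d one_pos
  set V := volume.real (ball (0 : EuclideanSpace ℝ (Fin d)) 1)
  refine Real.liminf_eq_of_tendsto_sub (squeeze_zero_norm' ?_ (a := fun α : ℝ => 2 * M * K / V *
    (((α + (dist z 0 + r)) ^ d - (α - r) ^ d) / α ^ d)) ?_)
  · filter_upwards [eventually_ge_atTop r] with α hα
    have hα₀ : 0 < α := hr.trans_le hα
    have hvol : ∀ w : EuclideanSpace ℝ (Fin d),
        (volume (closedBall w α)).toReal = α ^ d * V := fun w => by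
      have := Measure.addHaar_real_closedBall volume w hα₀.le
      rwa [finrank_euclideanSpace_fin] at this
    have hfinsum : ∀ w, (∑ᶠ (s : Finset (EuclideanSpace ℝ (Fin d)))
        (_ : s ∈ T.faces ∧ s.card = d + 1 ∧
          (s : Set (EuclideanSpace ℝ (Fin d))) ⊆ closedBall w α), F s) =
        ∑ s ∈ (hfin w α).toFinset, F s := fun w =>
      finsum_mem_eq_finite_toFinset_sum _ (hfin w α)
    rw [hvol, hvol, hfinsum, hfinsum, ← sub_div,
      ← Finset.sum_sdiff_sub_sum_sdiff, Real.norm_eq_abs, abs_div,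
      abs_of_pos (show 0 < α ^ d * V by positivity)]
    have h₁ := (Finset.abs_sum_le_sum_abs _ _).trans (hsum z 0 α hα)
    have h₂ := (Finset.abs_sum_le_sum_abs _ _).trans (hsum 0 z α hα)
    rw [dist_comm 0 z] at h₂
    calc _ ≤ (2 * M * K * ((α + (dist z 0 + r)) ^ d - (α - r) ^ d)) / (α ^ d * V) := by
          gcongr
          refine (abs_sub _ _).trans ?_
          linarith
      _ = _ := by field_simp
  · simpa using (tendsto_add_pow_sub_sub_pow_div_pow d (dist z 0 + r) r).const_mul (2 * M * K / V)
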